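/- Let m ≥ 1, let α₁,…,α_m > 0 and α = α₁+⋯+α_m, and let k : (ℝ^{2n+1})^m → [0,∞) be a measurable kernel with H_m := ∫_{(ℝ^{2n+1})^m} k(y₁,…,y_m) ∏_{i=1}^m |y_i|_h^{-α_i} dy₁⋯dy_m < ∞. Define T_m(f₁,…,f_m)(x) = ∫_{(ℝ^{2n+1})^m} k(y₁,…,y_m) f₁(δ_{|x|_h}y₁)⋯f_m(δ_{|x|_h}y_m) dy₁⋯dy_m for x ≠ 0. Then the operator norm of T_m from H^∞_{α₁}(ℍⁿ)×⋯×H^∞_{α_m}(ℍⁿ) to H^∞_α(ℍⁿ) (the least constant C with ‖T_m(f₁,…,f_m)‖_{H^∞_α} ≤ C ∏_{i=1}^m ‖f_i‖_{H^∞_{α_i}} for all f_i ∈ H^∞_{α_i}(ℍⁿ)) equals exactly H_m. -/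

import Mathlib

open MeasureTheory ENNReal

/-- The Korányi (homogeneous) norm on the Heisenberg group `ℍⁿ ≃ ℝ^{2n+1}`. -/
noncomputable def hnorm (n : ℕ) (x : Fin (2*n+1) → ℝ) : ℝ :=
  ((∑ i : Fin (2*n+1), if (i : ℕ) < 2*n then (x i)^2 else 0)^2
    + (x (Fin.last (2*n)))^2) ^ ((1:ℝ)/4)

/-- The Heisenberg dilations `δ_r`. -/
noncomputable def dil (n : ℕ) (r : ℝ) (x : Fin (2*n+1) → ℝ) : Fin (2*n+1) → ℝ :=
  fun i => if (i : ℕ) < 2*n then r * x i else r^2 * x i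

/-- The norm of the weighted-type space `H^∞_α(ℍⁿ)`:
`‖f‖ = ess sup_x |x|_h^α |f x|`. -/
noncomputable def wnorm (n : ℕ) (α : ℝ) (f : (Fin (2*n+1) → ℝ) → ℝ) : ℝ≥0∞ :=
  essSup (fun x => ENNReal.ofReal (hnorm n x ^ α * |f x|)) volume

/-- `Ω_Q`: the volume of the Korányi unit ball. -/
noncomputable def ΩQ (n : ℕ) : ℝ :=
  (volume {x : Fin (2*n+1) → ℝ | hnorm n x < 1}).toReal


theorem hnorm_nonneg' (n : ℕ) (x : Fin (2*n+1) → ℝ) : 0 ≤ hnorm n x := by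
  unfold hnorm; positivity

theorem hnorm_pos' (n : ℕ) (x : Fin (2*n+1) → ℝ) (hx : x ≠ 0) : 0 < hnorm n x := by
  rcases (hnorm_nonneg' n x).eq_or_lt with h | h
  swap
  · exact h
  exfalso
  apply hx
  unfold hnorm at h
  have hS : 0 ≤ (∑ i : Fin (2*n+1), if (i : ℕ) < 2*n then (x i)^2 else 0) :=
    Finset.sum_nonneg (fun i _ => by split_ifs <;> positivity)
  have h0 := (Real.rpow_eq_zero (by positivity) (by norm_num)).1 h.symm
  have h1 : (∑ i : Fin (2*n+1), if (i : ℕ) < 2*n then (x i)^2 else 0) = 0 := by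
    have : (∑ i : Fin (2*n+1), if (i : ℕ) < 2*n then (x i)^2 else 0)^2 = 0 := by
      nlinarith [sq_nonneg (x (Fin.last (2*n))),
        sq_nonneg (∑ i : Fin (2*n+1), if (i : ℕ) < 2*n then (x i)^2 else 0)]
    exact pow_eq_zero_iff (two_ne_zero) |>.1 this
  have h2 : x (Fin.last (2*n)) = 0 := by
    rw [h1] at h0
    have : (x (Fin.last (2*n)))^2 = 0 := by linarith
    exact pow_eq_zero_iff (two_ne_zero) |>.1 this
  rw [Finset.sum_eq_zero_iff_of_nonneg (fun i _ => by split_ifs <;> positivity)] at h1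
  funext i
  by_cases hi : (i : ℕ) < 2*n
  · have := h1 i (Finset.mem_univ _)
    rw [if_pos hi] at this
    exact pow_eq_zero_iff (two_ne_zero) |>.1 this
  · have : i = Fin.last (2*n) := by
      apply Fin.ext
      have := i.2
      simp only [Fin.val_last]
      omega
    rw [this, h2]; rfl

theorem measurable_hnorm (n : ℕ) : Measurable (hnorm n) := by
  unfold hnorm
  apply Measurable.pow_const
  apply Measurable.add
  · apply Measurable.pow_const
    apply Finset.measurable_sum
    intro i _
    split_ifs <;> fun_prop
  · fun_prop

theorem hnorm_dil (n : ℕ) (r : ℝ) (hr : 0 ≤ r) (x : Fin (2*n+1) → ℝ) :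
    hnorm n (dil n r x) = r * hnorm n x := by
  unfold hnorm dil
  have h1 : (∑ i : Fin (2*n+1), if (i : ℕ) < 2*n then
      (if (i : ℕ) < 2*n then r * x i else r^2 * x i)^2 else 0)
      = r^2 * ∑ i : Fin (2*n+1), if (i : ℕ) < 2*n then (x i)^2 else 0 := by
    rw [Finset.mul_sum]
    refine Finset.sum_congr rfl fun i _ => ?_
    split_ifs <;> ring
  rw [h1]
  simp only [Fin.val_last, lt_irrefl, if_false]
  set S := ∑ i : Fin (2*n+1), if (i : ℕ) < 2*n then (x i)^2 else 0
  have h2 : (r^2 * S)^2 + (r^2 * x (Fin.last (2*n)))^2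
      = r^4 * (S^2 + (x (Fin.last (2*n)))^2) := by ring
  rw [h2, Real.mul_rpow (by positivity) (by positivity)]
  congr 1
  rw [← Real.rpow_natCast, ← Real.rpow_mul hr]
  norm_num

theorem qmp_dil (n : ℕ) (r : ℝ) (hr : 0 < r) :
    Measure.QuasiMeasurePreserving (dil n r) volume volume := by
  have hdet : (Matrix.diagonal (fun i : Fin (2*n+1) => if (i : ℕ) < 2*n then r else r^2)).det ≠ 0 := by
    rw [Matrix.det_diagonal]
    refine Finset.prod_ne_zero_iff.2 fun i _ => ?_
    split_ifs <;> positivity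
  have he : dil n r = Matrix.toLin'
      (Matrix.diagonal (fun i : Fin (2*n+1) => if (i : ℕ) < 2*n then r else r^2)) := by
    funext x i
    simp only [dil, Matrix.toLin'_apply, Matrix.mulVec_diagonal]
    split_ifs <;> rfl
  have hm : Measurable (dil n r) := by
    rw [he]
    exact (LinearMap.continuous_of_finiteDimensional _).measurable
  refine ⟨hm, ?_⟩
  rw [he, Real.map_matrix_volume_pi_eq_smul_volume_pi hdet]
  exact Measure.smul_absolutelyContinuous

theorem ae_hnorm_pos (n : ℕ) :
    ∀ᵐ x : Fin (2*n+1) → ℝ, 0 < hnorm n x := by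
  have : ∀ᵐ x : Fin (2*n+1) → ℝ, x ≠ 0 := by
    rw [ae_iff]; simp
  filter_upwards [this] with x hx using hnorm_pos' n x hx

/-- the operator norm of the `m`-linear integral operator with
nonnegative kernel `k` from `H^∞_{α₁} × ⋯ × H^∞_{α_m}` to `H^∞_α` is exactly `H_m`,
i.e. `H_m` is the least admissible constant. -/
theorem statement1 (n : ℕ) (hn : 1 ≤ n) (m : ℕ) (hm : 1 ≤ m)
    (α : Fin m → ℝ) (hα : ∀ i, 0 < α i)
    (k : (Fin m → Fin (2*n+1) → ℝ) → ℝ)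
    (hkmeas : Measurable k) (hknonneg : ∀ y, 0 ≤ k y)
    (Hm : ℝ≥0∞)
    (hHm : Hm = ∫⁻ y : Fin m → Fin (2*n+1) → ℝ,
      ENNReal.ofReal (k y * ∏ i, hnorm n (y i) ^ (-(α i))))
    (hHmfin : Hm < ⊤) :
    IsLeast {C : ℝ≥0∞ | ∀ f : Fin m → (Fin (2*n+1) → ℝ) → ℝ,
        (∀ i, Measurable (f i)) → (∀ i, wnorm n (α i) (f i) < ⊤) →
        wnorm n (∑ i, α i)
            (fun x => ∫ y : Fin m → Fin (2*n+1) → ℝ,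
              k y * ∏ i, f i (dil n (hnorm n x) (y i)))
          ≤ C * ∏ i, wnorm n (α i) (f i)} Hm := by
  have hev : ∀ i : Fin m, Measure.QuasiMeasurePreserving
      (fun y : Fin m → Fin (2*n+1) → ℝ => y i) volume volume := fun i =>
    (Measure.quasiMeasurePreserving_eval (fun _ : Fin m => (volume : Measure (Fin (2*n+1) → ℝ))) i)
  have hgm : Measurable (fun y : Fin m → Fin (2*n+1) → ℝ =>
      k y * ∏ i, hnorm n (y i) ^ (-(α i))) := by
    refine hkmeas.mul (Finset.measurable_prod _ fun i _ => ?_)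
    exact ((measurable_hnorm n).comp (measurable_pi_apply i)).pow_const _
  have hg0 : ∀ y : Fin m → Fin (2*n+1) → ℝ,
      0 ≤ k y * ∏ i, hnorm n (y i) ^ (-(α i)) := fun y =>
    mul_nonneg (hknonneg y)
      (Finset.prod_nonneg fun i _ => Real.rpow_nonneg (hnorm_nonneg' n _) _)
  constructor
  · intro f hf hfin
    refine essSup_le_of_ae_le _ ?_
    filter_upwards [ae_hnorm_pos n] with x hx
    set r := hnorm n x with hr
    set N : Fin m → ℝ := fun i => (wnorm n (α i) (f i)).toReal with hN
    have hb : ∀ i, ∀ᵐ z : Fin (2*n+1) → ℝ, hnorm n z ^ (α i) * |f i z| ≤ N i := by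
      intro i
      have := ENNReal.ae_le_essSup (μ := volume)
        (fun z : Fin (2*n+1) → ℝ => ENNReal.ofReal (hnorm n z ^ (α i) * |f i z|))
      filter_upwards [this] with z hz
      exact (ENNReal.ofReal_le_iff_le_toReal (hfin i).ne).1 hz
    have hb' : ∀ᵐ y : Fin m → Fin (2*n+1) → ℝ, ∀ i,
        0 < hnorm n (y i) ∧
        hnorm n (dil n r (y i)) ^ (α i) * |f i (dil n r (y i))| ≤ N i := by
      rw [ae_all_iff]
      intro i
      exact ((hev i).ae (ae_hnorm_pos n)).and ((hev i).ae ((qmp_dil n r hx).ae (hb i)))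
    have hprodN : ∏ i, wnorm n (α i) (f i) = ENNReal.ofReal (∏ i, N i) := by
      rw [ENNReal.ofReal_prod_of_nonneg (fun i _ => ENNReal.toReal_nonneg)]
      exact Finset.prod_congr rfl fun i _ => (ENNReal.ofReal_toReal (hfin i).ne).symm
    rw [hprodN, hHm, ← lintegral_mul_const _ hgm.ennreal_ofReal,
      ENNReal.ofReal_mul (Real.rpow_nonneg hx.le _), ← Real.enorm_eq_ofReal_abs]
    refine (mul_le_mul_right (enorm_integral_le_lintegral_enorm _) _).trans ?_
    rw [← lintegral_const_mul' _ _ ENNReal.ofReal_ne_top]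
    refine lintegral_mono_ae ?_
    filter_upwards [hb'] with y hy
    rw [Real.enorm_eq_ofReal_abs, ← ENNReal.ofReal_mul (Real.rpow_nonneg hx.le _),
      ← ENNReal.ofReal_mul (hg0 y)]
    apply ENNReal.ofReal_le_ofReal
    rw [abs_mul, abs_of_nonneg (hknonneg y), Finset.abs_prod, Real.rpow_sum_of_pos hx,
      mul_left_comm, mul_assoc, ← Finset.prod_mul_distrib, ← Finset.prod_mul_distrib]
    refine mul_le_mul_of_nonneg_left ?_ (hknonneg y)
    refine Finset.prod_le_prod
      (fun i _ => mul_nonneg (Real.rpow_nonneg hx.le _) (abs_nonneg _)) fun i _ => ?_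
    obtain ⟨hp, hle⟩ := hy i
    rw [hnorm_dil n r hx.le, Real.mul_rpow hx.le hp.le] at hle
    have hq : 0 < hnorm n (y i) ^ (α i) := Real.rpow_pos_of_pos hp _
    rw [Real.rpow_neg hp.le, inv_mul_eq_div, le_div_iff₀ hq]
    linarith
  · intro C hC
    have hw : ∀ i, wnorm n (α i) (fun z => hnorm n z ^ (-(α i))) = 1 := by
      intro i
      unfold wnorm
      rw [← essSup_const (μ := (volume : Measure (Fin (2*n+1) → ℝ))) (1 : ℝ≥0∞)
        (NeZero.ne _)]
      apply essSup_congr_ae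
      filter_upwards [ae_hnorm_pos n] with z hz
      rw [abs_of_nonneg (Real.rpow_nonneg hz.le _), ← Real.rpow_add hz]
      simp
    have h := hC (fun i z => hnorm n z ^ (-(α i)))
      (fun i => (measurable_hnorm n).pow_const _) (fun i => by rw [hw i]; exact one_lt_top)
    simp only [hw, Finset.prod_const_one, mul_one] at h
    refine le_trans (le_of_eq ?_) h
    unfold wnorm
    rw [← essSup_const (μ := (volume : Measure (Fin (2*n+1) → ℝ))) Hm (NeZero.ne _)]
    apply essSup_congr_ae
    filter_upwards [ae_hnorm_pos n] with x hx
    have hI : ∫ y : Fin m → Fin (2*n+1) → ℝ,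
        k y * ∏ i, hnorm n (dil n (hnorm n x) (y i)) ^ (-(α i))
        = (hnorm n x ^ (∑ i, α i))⁻¹ * Hm.toReal := by
      rw [hHm, ← integral_eq_lintegral_of_nonneg_ae (Filter.Eventually.of_forall hg0)
        hgm.aestronglyMeasurable, ← integral_const_mul]
      refine integral_congr_ae (Filter.Eventually.of_forall fun y => ?_)
      simp only
      rw [Real.rpow_sum_of_pos hx, ← Finset.prod_inv_distrib, mul_left_comm,
        ← Finset.prod_mul_distrib]
      congr 1
      refine Finset.prod_congr rfl fun i _ => ?_
      rw [hnorm_dil n _ hx.le, Real.mul_rpow hx.le (hnorm_nonneg' n _), Real.rpow_neg hx.le]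
    have hq : 0 < hnorm n x ^ (∑ i, α i) := Real.rpow_pos_of_pos hx _
    rw [hI, abs_of_nonneg (mul_nonneg (inv_nonneg.2 hq.le) ENNReal.toReal_nonneg),
      mul_inv_cancel_left₀ hq.ne', ENNReal.ofReal_toReal hHmfin.ne]
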